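/- Let Y be a nonempty partially ordered set. Then Y is a quasilattice if and only if for every partially ordered set X and every finite subset A of X (with the induced order), every isotone map f : A → Y has an isotone extension g : X → Y. -/

import Mathlib

universe u

/-- In a quasilattice, a map that is monotone on a finite set `T` can be modified outside `T`
so as to be monotone on `insert x T`. -/
theorem exists_monotoneOn_insert {P Y : Type*} [PartialOrder P] [PartialOrder Y]
    (hY : ∀ A B : Set Y, A.Finite → B.Finite → (∀ a ∈ A, ∀ b ∈ B, a ≤ b) →
      ∃ y : Y, (∀ a ∈ A, a ≤ y) ∧ ∀ b ∈ B, y ≤ b)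
    {T : Set P} (hT : T.Finite) (x : P) {h : P → Y} (hh : MonotoneOn h T) :
    ∃ g : P → Y, MonotoneOn g (insert x T) ∧ Set.EqOn g h T := by
  classical
  by_cases hx : x ∈ T
  · exact ⟨h, by rwa [Set.insert_eq_of_mem hx], fun _ _ => rfl⟩
  obtain ⟨y, hlo, hup⟩ := hY (h '' {s ∈ T | s ≤ x}) (h '' {s ∈ T | x ≤ s})
    ((hT.subset (Set.sep_subset _ _)).image h) ((hT.subset (Set.sep_subset _ _)).image h) (by
      rintro _ ⟨s, ⟨hs, hsx⟩, rfl⟩ _ ⟨t, ⟨ht, hxt⟩, rfl⟩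
      exact hh hs ht (hsx.trans hxt))
  have hne : ∀ s ∈ T, s ≠ x := fun s hs hsx => hx (hsx ▸ hs)
  refine ⟨Function.update h x y, ?_, fun s hs => Function.update_of_ne (hne s hs) _ _⟩
  rintro s (rfl | hs) t (rfl | ht) hst
  · exact le_rfl
  · rw [Function.update_self, Function.update_of_ne (hne t ht)]
    exact hup _ ⟨t, ⟨ht, hst⟩, rfl⟩
  · rw [Function.update_self, Function.update_of_ne (hne s hs)]
    exact hlo _ ⟨s, ⟨hs, hst⟩, rfl⟩
  · rw [Function.update_of_ne (hne s hs), Function.update_of_ne (hne t ht)]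
    exact hh hs ht hst

/-- A map from a finite poset to a quasilattice that is monotone on a subset `T` agrees on `T`
with a monotone map. -/
theorem exists_monotone_eqOn_of_finite {P Y : Type*} [PartialOrder P] [Finite P]
    [PartialOrder Y]
    (hY : ∀ A B : Set Y, A.Finite → B.Finite → (∀ a ∈ A, ∀ b ∈ B, a ≤ b) →
      ∃ y : Y, (∀ a ∈ A, a ≤ y) ∧ ∀ b ∈ B, y ≤ b)
    (T : Set P) {h : P → Y} (hh : MonotoneOn h T) :
    ∃ g : P → Y, Monotone g ∧ Set.EqOn g h T := by
  have key : ∀ S : Set P, S.Finite →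
      ∃ g : P → Y, MonotoneOn g (S ∪ T) ∧ Set.EqOn g h T := by
    intro S hS
    induction S, hS using Set.Finite.induction_on with
    | empty => exact ⟨h, by simpa using hh, fun _ _ => rfl⟩
    | @insert x S _ _ ih =>
      obtain ⟨g, hg, hgh⟩ := ih
      obtain ⟨g', hg', hgg⟩ := exists_monotoneOn_insert hY (Set.toFinite (S ∪ T)) x hg
      exact ⟨g', by rwa [Set.insert_union],
        fun s hs => (hgg (Or.inr hs)).trans (hgh hs)⟩
  obtain ⟨g, hg, hgh⟩ := key Set.univ Set.finite_univ
  exact ⟨g, by rwa [Set.univ_union, monotoneOn_univ] at hg, hgh⟩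

/-- A nonempty poset `Y` is a quasilattice iff for every poset `X` and
every finite `A ⊆ X` (induced order), every isotone `f : A → Y` has an isotone extension
`g : X → Y`. -/
theorem quasilattice_iff_extension_of_finite_subsets {Y : Type u} [PartialOrder Y]
    [Nonempty Y] :
    (∀ A B : Set Y, A.Finite → B.Finite →
      (∀ a ∈ A, ∀ b ∈ B, a ≤ b) →
        ∃ y : Y, (∀ a ∈ A, a ≤ y) ∧ ∀ b ∈ B, y ≤ b) ↔
      (∀ (X : Type u) [PartialOrder X] (A : Set X), A.Finite → ∀ f : A → Y,
        Monotone f → ∃ g : X → Y, Monotone g ∧ ∀ a : A, g (a : X) = f a) := by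
  constructor
  · intro hY X _ A hA f hf
    have : Finite A := hA
    -- `X` maps monotonically to the finite poset `Set A`, and `A` embeds in it.
    let L : X → Set A := fun x => {a | (a : X) ≤ x}
    have hL : Monotone L := fun x y hxy a ha => le_trans ha hxy
    have hLA : ∀ a b : A, L a ≤ L b → a ≤ b := fun a b hab => hab (le_refl (a : X))
    have hinj : Function.Injective fun a : A => L a := fun a b hab =>
      le_antisymm (hLA a b (le_of_eq hab)) (hLA b a (ge_of_eq hab))
    let h : Set A → Y := Function.extend (fun a : A => L a) f fun _ => Classical.arbitrary Y
    have hf' : ∀ a : A, h (L a) = f a := fun a => hinj.extend_apply f _ a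
    obtain ⟨g, hg, hgh⟩ := exists_monotone_eqOn_of_finite hY
      (Set.range fun a : A => L a) (h := h) (by
        rintro _ ⟨a, rfl⟩ _ ⟨b, rfl⟩ hab
        simp only [hf']
        exact hf (hLA a b hab))
    exact ⟨g ∘ L, hg.comp hL, fun a => (hgh ⟨a, rfl⟩).trans (hf' a)⟩
  · intro hext A B hA hB hAB
    have : Finite A := hA
    have : Finite B := hB
    -- The ordinal sum of `A`, a point and `B`.
    let X := (A ⊕ₗ PUnit.{u + 1}) ⊕ₗ B
    let lo : A → X := fun a => Sum.inlₗ (Sum.inlₗ a)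
    let mid : X := Sum.inlₗ (Sum.inrₗ PUnit.unit)
    let up : B → X := fun b => Sum.inrₗ b
    let v : X → Y := fun x => Sum.elim
      (fun z => Sum.elim (fun a : A => (a : Y)) (fun _ => Classical.arbitrary Y) (ofLex z))
      (fun b : B => (b : Y)) (ofLex x)
    obtain ⟨g, hg, hgv⟩ := hext X (Set.range lo ∪ Set.range up)
      ((Set.finite_range lo).union (Set.finite_range up)) (fun x => v x) (by
        rintro ⟨_, ⟨a, rfl⟩ | ⟨b, rfl⟩⟩ ⟨_, ⟨a', rfl⟩ | ⟨b', rfl⟩⟩ hle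
        · have haa : a ≤ a' := Sum.Lex.inl_le_inl_iff.1 (Sum.Lex.inl_le_inl_iff.1 hle)
          exact haa
        · exact hAB a a.2 b' b'.2
        · exact (Sum.Lex.not_inr_le_inl hle).elim
        · have hbb : b ≤ b' := Sum.Lex.inr_le_inr_iff.1 hle
          exact hbb)
    refine ⟨g mid, fun a ha => ?_, fun b hb => ?_⟩
    · rw [← show g (lo ⟨a, ha⟩) = a from hgv ⟨_, Or.inl ⟨_, rfl⟩⟩]
      exact hg (Sum.Lex.inl_le_inl_iff.2 (Sum.Lex.inl_le_inr _ _))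
    · rw [← show g (up ⟨b, hb⟩) = b from hgv ⟨_, Or.inr ⟨_, rfl⟩⟩]
      exact hg (Sum.Lex.inl_le_inr _ _)
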